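/- For every natural number k, the following identity of polynomials in y and q holds: Σ over pairs (P, w), where P is a Motzkin path of length k and w assigns to each up step of P starting at height h a weight in {1, −q^{h+1}}, to each level step starting at height h the weight −(1+y·q)·q^h, and to each down step starting at height h a weight in {y, −y·q^h}, such that P has no peak (an up step immediately followed by a down step) whose up step is assigned weight 1 and whose down step is assigned weight y, of the product of the assigned weights of all steps, equals (−1)^k · Σ_{i=0}^{k} y^i · q^{i(k+1−i)}. -/

import Mathlib

open Finset

inductive Step : Type
  | U | L | D
deriving DecidableEq

instance : Fintype Step where
  elems := {Step.U, Step.L, Step.D}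
  complete := fun x => by cases x <;> decide

/-- The vertical displacement of a step: up = +1, level = 0, down = -1. -/
def Step.val : Step → ℤ
  | .U => 1
  | .L => 0
  | .D => -1

/-- The partial sum of the step values of the first `i` steps;
this is the height at which step `i` starts. -/
def hsum {n : ℕ} (P : Fin n → Step) (i : ℕ) : ℤ :=
  ∑ j ∈ Finset.univ.filter (fun j : Fin n => (j : ℕ) < i), (P j).val

/-- A Motzkin path: all partial sums nonnegative and total sum 0. -/
abbrev IsMotzkin {n : ℕ} (P : Fin n → Step) : Prop :=
  (∀ i : Fin (n+1), 0 ≤ hsum P (i : ℕ)) ∧ hsum P n = 0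

/-- A Motzkin prefix of final height `k`: all partial sums nonnegative, total sum `k`. -/
abbrev IsMPrefix {n : ℕ} (P : Fin n → Step) (k : ℕ) : Prop :=
  (∀ i : Fin (n+1), 0 ≤ hsum P (i : ℕ)) ∧ hsum P n = (k : ℤ)

/-- `[h]_q = 1 + q + ... + q^(h-1)`. -/
def geo {R : Type*} [CommSemiring R] (q : R) (h : ℤ) : R :=
  ∑ i ∈ Finset.range h.toNat, q ^ i

/-- The Gaussian (q-)binomial coefficient, via the q-Pascal recurrence. -/
def qbinom {R : Type*} [CommSemiring R] (q : R) : ℕ → ℕ → R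
  | _, 0 => 1
  | 0, _+1 => 0
  | n+1, k+1 => qbinom q n k + q ^ (k+1) * qbinom q n (k+1)

/-- The binomial coefficient with integer lower argument, zero on negative arguments. -/
def ch (m : ℕ) (j : ℤ) : ℤ := if 0 ≤ j then m.choose j.toNat else 0

namespace MZ

section alg
variable {R : Type*} [CommRing R]

def G (q : R) : ℕ → ℕ → R
  | 0, _ => 1
  | _+1, 0 => 1
  | h+1, a+1 => G q h (a+1) + q ^ (h+1) * G q (h+1) a

lemma G_zero_right (q : R) (h : ℕ) : G q h 0 = 1 := by cases h <;> simp [G]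
lemma G_zero_left (q : R) (a : ℕ) : G q 0 a = 1 := by simp [G]
lemma G_succ (q : R) (h a : ℕ) :
    G q (h+1) (a+1) = G q h (a+1) + q ^ (h+1) * G q (h+1) a := by rw [G]

lemma G_rel (q : R) (h a : ℕ) :
    (1 - q^(h+1)) * G q (h+1) a = (1 - q^(a+1)) * G q h (a+1) := by
  induction h generalizing a with
  | zero =>
    induction a with
    | zero => simp [G]
    | succ a ih =>
      rw [G_succ, G_zero_left, G_zero_left]
      rw [G_zero_left] at ih
      linear_combination q * ih
  | succ h ihh =>
    induction a with
    | zero =>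
      have := ihh 0
      rw [G_succ, G_zero_right, G_zero_right] at *
      linear_combination this
    | succ a iha =>
      have h1 := ihh (a+1)
      rw [G_succ q (h+1) a, G_succ q h (a+1)]
      linear_combination q ^ (h+2) * iha + h1

def e (q : R) (h a l : ℕ) : R := q ^ (a*(l+1)) * G q h a * G q h l

lemma e_left (q : R) (h l : ℕ) : e q h 0 l = G q h l := by simp [e, G_zero_right]
lemma e_right (q : R) (h a : ℕ) : e q h a 0 = q ^ a * G q h a := by simp [e, G_zero_right]

lemma e_up (q : R) (h a l : ℕ) : (1 - q^(h+1))^2 * e q (h+1) a l =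
    q ^ (a*(l+1)) * ((1 - q^(a+1)) * (1 - q^(l+1))) * G q h (a+1) * G q h (l+1) := by
  unfold e
  have h1 := G_rel q h a
  have h2 := G_rel q h l
  linear_combination q ^ (a*(l+1)) * ((1 - q^(h+1)) * G q (h+1) l) * h1
    + q ^ (a*(l+1)) * ((1 - q^(a+1)) * G q h (a+1)) * h2

lemma e_zero (q : R) (a l : ℕ) : e q 0 (a+1) (l+1) = e q 0 (a+1) l + q * e q 0 a (l+1)
    + (1 - q)^2 * e q 1 a l - e q 0 a l := by
  have := e_up q 0 a l
  rw [zero_add, pow_one] at this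
  rw [this]
  simp only [e, G_zero_left]
  ring

lemma e_succ (q : R) (h a l : ℕ) : e q (h+1) (a+1) (l+1) = e q h (a+1) (l+1)
    + q^(h+1) * e q (h+1) (a+1) l + q^(h+2) * e q (h+1) a (l+1)
    + (1 - q^(h+2))^2 * e q (h+2) a l - e q (h+1) a l := by
  rw [e_up q (h+1) a l]
  have h1 := G_rel q h a
  have h2 := G_rel q h l
  simp only [e, G_succ]
  generalize G q h (a+1) = u at *
  generalize G q (h+1) a = v at *
  generalize G q h (l+1) = x at *
  generalize G q (h+1) l = z at *
  have e1 : q ^ ((a+1)*(l+1+1)) = q^(a*(l+1)) * q^(a+1) * q^(l+1) := by ring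
  have e2 : q ^ ((a+1)*(l+1)) = q^(a*(l+1)) * q^(l+1) := by ring
  have e3 : q ^ (h+2) * q ^ (a*(l+1+1)) = q^(h+1) * q^(a*(l+1)) * q^(a+1) := by ring
  rw [e1, e2, ← mul_assoc (q^(h+2)), ← mul_assoc (q^(h+2)), e3]
  generalize q ^ (a*(l+1)) = t at *
  generalize q ^ (a+1) = p at *
  generalize q ^ (l+1) = r at *
  generalize q ^ (h+1) = s at *
  have h3 : (1-p) * (u + s*v) = v * (1 - s*p) := by linear_combination -h1
  have h4 : (1-r) * (x + s*z) = z * (1 - s*r) := by linear_combination -h2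
  linear_combination -t * ((1-r) * (x + s*z)) * h3 - t * v * (1 - s*p) * h4 
    + t * s * r * z * h1 + t * s * p * v * h2

def f (y q : R) (d h : ℕ) : R := ∑ x ∈ Finset.HasAntidiagonal.antidiagonal d, y ^ x.1 * e q h x.1 x.2

lemma f_zero (y q : R) (h : ℕ) : f y q 0 h = 1 := by simp [f, e, G_zero_right]

lemma f_one (y q : R) (h : ℕ) : f y q 1 h = (1 + y * q) * G q h 1 := by
  rw [f, Finset.Nat.sum_antidiagonal_succ]
  simp [e, G_zero_right]; ring

lemma f_one_succ (y q : R) (h : ℕ) :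
    f y q 1 (h+1) = f y q 1 h + (1 + y*q) * q^(h+1) * f y q 0 (h+1) := by
  rw [f_one, f_one, f_zero, G_succ, G_zero_right]; ring

lemma f_split (y q : R) (d h : ℕ) : f y q (d+2) h = G q h (d+2) + y^(d+2) * (q^(d+2) * G q h (d+2))
    + ∑ x ∈ Finset.HasAntidiagonal.antidiagonal d, y ^ (x.1+1) * e q h (x.1+1) (x.2+1) := by
  rw [f, Finset.Nat.sum_antidiagonal_succ, Finset.Nat.sum_antidiagonal_succ']
  simp only [e_left, e_right]
  ring

lemma f_splitA (y q : R) (d h : ℕ) : f y q (d+1) h = G q h (d+1)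
    + ∑ x ∈ Finset.HasAntidiagonal.antidiagonal d, y ^ (x.1+1) * e q h (x.1+1) x.2 := by
  rw [f, Finset.Nat.sum_antidiagonal_succ]
  simp only [e_left]
  ring

lemma f_splitB (y q : R) (d h : ℕ) : f y q (d+1) h = y^(d+1) * (q^(d+1) * G q h (d+1))
    + ∑ x ∈ Finset.HasAntidiagonal.antidiagonal d, y ^ x.1 * e q h x.1 (x.2+1) := by
  rw [f, Finset.Nat.sum_antidiagonal_succ']
  simp only [e_right]

lemma f_rec_zero (y q : R) (d : ℕ) : f y q (d+2) 0 = (1 + y*q) * f y q (d+1) 0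
    + y * (1-q)^2 * f y q d 1 - y * f y q d 0 := by
  have hs : ∑ x ∈ Finset.HasAntidiagonal.antidiagonal d, y ^ (x.1+1) * e q 0 (x.1+1) (x.2+1) =
      ∑ x ∈ Finset.HasAntidiagonal.antidiagonal d, y ^ (x.1+1) * e q 0 (x.1+1) x.2
      + y * q * ∑ x ∈ Finset.HasAntidiagonal.antidiagonal d, y ^ x.1 * e q 0 x.1 (x.2+1)
      + y * (1-q)^2 * f y q d 1 - y * f y q d 0 := by
    simp only [f, Finset.mul_sum, ← Finset.sum_add_distrib, ← Finset.sum_sub_distrib]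
    refine Finset.sum_congr rfl fun x _ => ?_
    rw [e_zero]; ring
  have h1 := f_split y q d 0
  have h2 := f_splitA y q d 0
  have h3 := f_splitB y q d 0
  simp only [G_zero_left] at h1 h2 h3
  linear_combination h1 - h2 - y * q * h3 + hs

lemma f_rec_succ (y q : R) (d h : ℕ) : f y q (d+2) (h+1) = f y q (d+2) h
    + (1 + y*q) * q^(h+1) * f y q (d+1) (h+1)
    + y * (1-q^(h+2))^2 * f y q d (h+2) - y * f y q d (h+1) := by
  have hs : ∑ x ∈ Finset.HasAntidiagonal.antidiagonal d, y ^ (x.1+1) * e q (h+1) (x.1+1) (x.2+1) =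
      ∑ x ∈ Finset.HasAntidiagonal.antidiagonal d, y ^ (x.1+1) * e q h (x.1+1) (x.2+1)
      + q^(h+1) * ∑ x ∈ Finset.HasAntidiagonal.antidiagonal d, y ^ (x.1+1) * e q (h+1) (x.1+1) x.2
      + y * q^(h+2) * ∑ x ∈ Finset.HasAntidiagonal.antidiagonal d, y ^ x.1 * e q (h+1) x.1 (x.2+1)
      + y * (1-q^(h+2))^2 * ∑ x ∈ Finset.HasAntidiagonal.antidiagonal d, y ^ x.1 * e q (h+2) x.1 x.2
      - y * ∑ x ∈ Finset.HasAntidiagonal.antidiagonal d, y ^ x.1 * e q (h+1) x.1 x.2 := by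
    simp only [Finset.mul_sum, ← Finset.sum_add_distrib, ← Finset.sum_sub_distrib]
    refine Finset.sum_congr rfl fun x _ => ?_
    rw [e_succ]; ring
  have h1 := f_split y q d (h+1)
  have h2 := f_splitA y q d (h+1)
  have h3 := f_splitB y q d (h+1)
  have h4 := f_split y q d h
  have h5 := G_succ q h (d+1)
  rw [← f, ← f] at hs
  linear_combination h1 - h4 - q^(h+1) * h2 - y * q^(h+2) * h3 + hs
    + (1 + y^(d+2) * q^(d+2)) * h5

def K (q : R) (h : ℕ) : R := ∏ t ∈ range h, (1 - q^(t+1))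

def Fc (y q : R) (n h : ℕ) : R :=
  if n < h then 0 else (-1)^(n-h) * y^h * K q h * f y q (n-h) h

lemma Fc_lt (y q : R) {n h : ℕ} (hn : n < h) : Fc y q n h = 0 := by simp [Fc, hn]
lemma Fc_add (y q : R) (h d n : ℕ) (hn : n = h + d) :
    Fc y q n h = (-1)^d * y^h * K q h * f y q d h := by simp [Fc, hn]
lemma K_succ (q : R) (h : ℕ) : K q (h+1) = K q h * (1 - q^(h+1)) := by
  simp [K, Finset.prod_range_succ]

lemma Fc_one_zero (y q : R) : Fc y q 1 0 = -(1+y*q) := by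
  rw [Fc_add y q 0 1 1 rfl, f_one]; simp [K, G_zero_left]

lemma Fc_one_one (y q : R) : Fc y q 1 1 = y * (1 - q) := by
  rw [Fc_add y q 1 0 1 rfl, f_zero]; simp [K]

lemma Fc_rec_zero (y q : R) (n : ℕ) : Fc y q (n+2) 0 =
    (1 - q) * Fc y q (n+1) 1 - y * Fc y q n 0 - (1+y*q) * Fc y q (n+1) 0 := by
  rw [Fc_add y q 0 (n+2) (n+2) (by omega), Fc_add y q 1 n (n+1) (by omega),
    Fc_add y q 0 n n (by omega), Fc_add y q 0 (n+1) (n+1) (by omega), f_rec_zero]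
  simp [K]; ring

lemma Fc_rec_succ (y q : R) (n h : ℕ) : Fc y q (n+2) (h+1) =
    (1 - q^(h+2)) * Fc y q (n+1) (h+2) - y * Fc y q n (h+1)
      - (1+y*q) * q^(h+1) * Fc y q (n+1) (h+1) + y * (1-q^(h+1)) * Fc y q (n+1) h := by
  rcases lt_or_ge (n+2) (h+1) with hc | hc
  · rw [Fc_lt, Fc_lt, Fc_lt, Fc_lt, Fc_lt] <;> first | omega | ring
  obtain ⟨d, hd⟩ := Nat.exists_eq_add_of_le hc
  match d, hd with
  | 0, hd =>
    rw [Fc_add y q (h+1) 0 _ hd, Fc_lt y q (h := h+2) (by omega), Fc_lt y q (h := h+1) (by omega),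
      Fc_lt y q (h := h+1) (by omega), Fc_add y q h 0 _ (by omega), K_succ, f_zero, f_zero]
    ring
  | 1, hd =>
    rw [Fc_add y q (h+1) 1 _ hd, Fc_lt y q (h := h+2) (by omega), Fc_lt y q (h := h+1) (by omega),
      Fc_add y q (h+1) 0 _ (by omega), Fc_add y q h 1 _ (by omega), K_succ, f_one_succ]
    ring
  | d+2, hd =>
    rw [Fc_add y q (h+1) (d+2) _ hd, Fc_add y q (h+2) d _ (by omega),
      Fc_add y q (h+1) d _ (by omega),
      Fc_add y q (h+1) (d+1) _ (by omega), Fc_add y q h (d+2) _ (by omega), K_succ q (h+1),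
      K_succ, f_rec_succ]
    ring

/-- step factor -/
def g (y q : R) (h : ℤ) : Step → Bool → R
  | .U, true => 1
  | .U, false => -q^(h.toNat+1)
  | .L, true => -(1+y*q) * q^h.toNat
  | .L, false => 0
  | .D, true => y
  | .D, false => -(y*q^h.toNat)

def S (y q : R) : ℕ → ℤ → Bool → R
  | 0, h, _ => if h = 0 then 1 else 0
  | n+1, h, b => if h < 0 then 0 else ∑ s : Step, ∑ x : Bool,
      if b = true ∧ s = .D ∧ x = true then 0 else
        g y q h s x * S y q n (h + s.val) (decide (s = .U ∧ x = true))

lemma sum_step (F : Step → R) : ∑ s, F s = F .U + F .L + F .D := by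
  have : (univ : Finset Step) = {Step.U, Step.L, Step.D} := rfl
  rw [this]; simp; ring

lemma S_neg (y q : R) (n : ℕ) (h : ℤ) (b : Bool) (hh : h < 0) : S y q n h b = 0 := by
  cases n <;> simp [S, hh]; omega

lemma S_false (y q : R) (n : ℕ) (h : ℕ) : S y q (n+1) h false =
    S y q n (h+1) true - q^(h+1) * S y q n (h+1) false - (1+y*q) * q^h * S y q n h false
     + y * (1 - q^h) * S y q n (h-1) false := by
  have : ¬ ((h:ℤ) < 0) := by omega
  simp [S, sum_step, g, Step.val, this, ← sub_eq_add_neg]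
  ring

lemma S_true (y q : R) (n : ℕ) (h : ℕ) : S y q (n+1) h true =
    S y q (n+1) h false - y * S y q n (h-1) false := by
  have : ¬ ((h:ℤ) < 0) := by omega
  simp [S, sum_step, g, Step.val, this, ← sub_eq_add_neg]
  ring

lemma S_eq (y q : R) (n : ℕ) : (∀ h : ℕ, S y q n h false = Fc y q n h) ∧
    (∀ h : ℕ, S y q (n+1) h false = Fc y q (n+1) h) := by
  induction n with
  | zero =>
    have h0 : ∀ h : ℕ, S y q 0 h false = Fc y q 0 h := by
      intro h
      rcases Nat.eq_zero_or_pos h with rfl | hp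
      · rw [Fc_add y q 0 0 0 rfl]; simp [S, K, f_zero]
      · rw [Fc_lt y q hp]; simp [S]; omega
    refine ⟨h0, fun h => ?_⟩
    rw [S_false]
    match h with
    | 0 => rw [zero_add, Fc_one_zero]; simp [S]
    | 1 => rw [zero_add, Fc_one_one]; simp [S]
    | h+2 =>
      rw [Fc_lt y q (by omega)]; simp only [S]
      rw [if_neg (by omega), if_neg (by omega), if_neg (by omega)]; ring
  | succ n ih =>
    obtain ⟨ih0, ih1⟩ := ih
    refine ⟨ih1, fun h => ?_⟩
    have e1 : ((h:ℤ)+1) = ((h+1:ℕ):ℤ) := by push_cast; rfl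
    rw [S_false, e1, S_true, ← e1, add_sub_cancel_right, e1, ih0, ih1, ih1]
    match h with
    | 0 => rw [Fc_rec_zero]; simp; ring
    | h+1 =>
      have e2 : (((h+1:ℕ):ℤ)-1) = (h:ℤ) := by push_cast; ring
      rw [e2, ih1, Fc_rec_succ]; ring


lemma hsum_zero {n : ℕ} (P : Fin n → Step) : hsum P 0 = 0 := by simp [hsum]

lemma hsum_cons {n : ℕ} (s : Step) (P : Fin n → Step) (i : ℕ) :
    hsum (Fin.cons s P : Fin (n+1) → Step) (i+1) = s.val + hsum P i := by
  simp only [hsum, Finset.sum_filter]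
  rw [Fin.sum_univ_succ]
  simp

def cond {n : ℕ} (P : Fin n → Step) (w : Fin n → Bool) (h : ℤ) (b : Bool) : Prop :=
  (∀ i : Fin (n+1), 0 ≤ h + hsum P (i : ℕ)) ∧ h + hsum P n = 0 ∧
  (∀ i, P i = Step.L → w i = true) ∧
  (∀ a c : Fin n, (c : ℕ) = (a : ℕ) + 1 →
            ¬(P a = Step.U ∧ P c = Step.D ∧ w a = true ∧ w c = true)) ∧
  (∀ i : Fin n, (i : ℕ) = 0 → ¬ (b = true ∧ P i = Step.D ∧ w i = true))

lemma cond_cons {n : ℕ} (s : Step) (x : Bool) (P : Fin n → Step) (w : Fin n → Bool)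
    (h : ℤ) (b : Bool) :
    cond (Fin.cons s P : Fin (n+1) → Step) (Fin.cons x w : Fin (n+1) → Bool) h b ↔
     0 ≤ h ∧ (s = Step.L → x = true) ∧ ¬ (b = true ∧ s = Step.D ∧ x = true) ∧
      cond P w (h + s.val) (decide (s = Step.U ∧ x = true)) := by
  unfold cond
  rw [Fin.forall_fin_succ (n := n+1), Fin.forall_fin_succ (P := fun i =>
    (Fin.cons s P : Fin (n+1) → Step) i = Step.L → (Fin.cons x w : Fin (n+1) → Bool) i = true),
    Fin.forall_fin_succ (P := fun i : Fin (n+1) => (i:ℕ) = 0 → _)]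
  have hp : (∀ a c : Fin (n+1), (c : ℕ) = (a : ℕ) + 1 →
      ¬((Fin.cons s P : Fin (n+1) → Step) a = Step.U ∧ (Fin.cons s P : Fin (n+1) → Step) c = Step.D
       ∧ (Fin.cons x w : Fin (n+1) → Bool) a = true ∧ (Fin.cons x w : Fin (n+1) → Bool) c = true)) ↔
      (∀ i : Fin n, (i : ℕ) = 0 → ¬ (s = Step.U ∧ P i = Step.D ∧ x = true ∧ w i = true)) ∧
      (∀ a c : Fin n, (c : ℕ) = (a : ℕ) + 1 →
            ¬(P a = Step.U ∧ P c = Step.D ∧ w a = true ∧ w c = true)) := by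
    simp [Fin.forall_fin_succ (n := n)]
  rw [hp]
  simp only [Fin.val_zero, hsum_zero, Fin.val_succ, hsum_cons, Fin.cons_zero, Fin.cons_succ,
    add_zero, ← add_assoc, decide_eq_true_eq]
  constructor
  · rintro ⟨⟨h1, h2⟩, h3, ⟨h4, h5⟩, ⟨h6, h7⟩, h8, h9⟩
    exact ⟨h1, h4, h8 trivial, h2, h3, h5, h7, fun i hi hh => h6 i hi ⟨hh.1.1, hh.2.1, hh.1.2, hh.2.2⟩⟩
  · rintro ⟨h1, h4, h8, h2, h3, h5, h7, h6⟩
    exact ⟨⟨h1, h2⟩, h3, ⟨h4, h5⟩, ⟨fun i hi hh => h6 i hi ⟨⟨hh.1, hh.2.2.1⟩, hh.2.1, hh.2.2.2⟩, h7⟩,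
      fun _ => h8, fun i hi => by omega⟩

open Classical in
lemma sum_cond (y q : R) (n : ℕ) (h : ℤ) (b : Bool) :
    (∑ P : Fin n → Step, ∑ w : Fin n → Bool,
      if cond P w h b then ∏ i : Fin n, g y q (h + hsum P (i:ℕ)) (P i) (w i) else 0) = S y q n h b := by
  induction n generalizing h b with
  | zero =>
    have : ∀ (P : Fin 0 → Step) (w : Fin 0 → Bool), cond P w h b ↔ h = 0 := by
      intro P w
      simp [cond, hsum]
      omega
    simp [this, S]
  | succ n ih =>
    rw [← (Fin.consEquiv (fun _ : Fin (n+1) => Step)).sum_comp, Fintype.sum_prod_type, S]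
    by_cases hh : h < 0
    · rw [if_pos hh]
      refine Finset.sum_eq_zero fun s _ => Finset.sum_eq_zero fun P _ =>
        Finset.sum_eq_zero fun w _ => if_neg fun hc => ?_
      have := hc.1 0
      simp [hsum_zero] at this
      omega
    rw [if_neg hh]
    refine Finset.sum_congr rfl fun s _ => ?_
    rw [Finset.sum_congr rfl (fun P _ => 
      ((Fin.consEquiv (fun _ : Fin (n+1) => Bool)).sum_comp _).symm)]
    simp only [Fintype.sum_prod_type]
    rw [Finset.sum_comm]
    refine Finset.sum_congr rfl fun x _ => ?_
    have hcS : ∀ P : Fin n → Step, (Fin.consEquiv (fun _ : Fin (n+1) => Step)) (s, P)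
      = (Fin.cons s P : Fin (n+1) → Step) := fun _ => rfl
    have hcB : ∀ w : Fin n → Bool, (Fin.consEquiv (fun _ : Fin (n+1) => Bool)) (x, w)
      = (Fin.cons x w : Fin (n+1) → Bool) := fun _ => rfl
    simp only [hcS, hcB, cond_cons, Fin.prod_univ_succ, Fin.cons_zero, Fin.cons_succ,
      Fin.val_zero, hsum_zero, Fin.val_succ, hsum_cons, add_zero, ← add_assoc, ← ih]
    split_ifs with hb
    · refine Finset.sum_eq_zero fun P _ => Finset.sum_eq_zero fun w _ => if_neg fun hc => ?_
      exact hc.2.2.1 hb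
    · simp only [Finset.mul_sum]
      refine Finset.sum_congr rfl fun P _ => Finset.sum_congr rfl fun w _ => ?_
      by_cases hl : s = Step.L → x = true
      · have : 0 ≤ h := by omega
        have h2 : ∀ c : Prop, (0 ≤ h ∧ (s = Step.L → x = true) ∧
            ¬(b = true ∧ s = Step.D ∧ x = true) ∧ c) ↔ c := fun c =>
          ⟨fun hc => hc.2.2.2, fun hc => ⟨this, hl, hb, hc⟩⟩
        simp only [h2, mul_ite, mul_zero]
      · have : g y q h s x = 0 := by
          push Not at hl
          obtain ⟨rfl, hx⟩ := hl
          have : x = false := by simpa using hx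
          subst this; rfl
        simp [this]

end alg
end MZ

open MvPolynomial in
/-- The total weight of labelled Motzkin paths of length `k` (up steps labelled
`1` or `-q^(h+1)`, level steps weighted `-(1+y·q)·q^h`, down steps labelled `y`
or `-y·q^h`, no peak labelled `(1, y)`) is `(-1)^k ∑_i y^i q^(i(k+1-i))`.
Here `y = X 0`, `q = X 1`, and the label `w` is canonically `true` on level steps. -/
theorem stmt17 (k : ℕ) :
    (∑ pw ∈ Finset.univ.filter
        (fun pw : (Fin k → Step) × (Fin k → Bool) =>
          IsMotzkin pw.1 ∧ (∀ i, pw.1 i = Step.L → pw.2 i = true) ∧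
          ∀ a b : Fin k, (b : ℕ) = (a : ℕ) + 1 →
            ¬(pw.1 a = Step.U ∧ pw.1 b = Step.D ∧ pw.2 a = true ∧ pw.2 b = true)),
      ∏ i, (match pw.1 i with
            | Step.U =>
                if pw.2 i then 1
                else -(X 1 : MvPolynomial (Fin 2) ℤ) ^ ((hsum pw.1 (i : ℕ)).toNat + 1)
            | Step.L => -(1 + (X 0 : MvPolynomial (Fin 2) ℤ) * X 1) *
                (X 1) ^ (hsum pw.1 (i : ℕ)).toNat
            | Step.D =>
                if pw.2 i then (X 0 : MvPolynomial (Fin 2) ℤ)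
                else -((X 0 : MvPolynomial (Fin 2) ℤ) *
                  (X 1) ^ (hsum pw.1 (i : ℕ)).toNat)))
    = (-1 : MvPolynomial (Fin 2) ℤ) ^ k *
        ∑ i ∈ Finset.range (k+1),
          (X 0 : MvPolynomial (Fin 2) ℤ) ^ i * (X 1) ^ (i * (k + 1 - i)) := by
  have key := (MZ.S_eq (X 0 : MvPolynomial (Fin 2) ℤ) (X 1) k).1 0
  rw [MZ.Fc_add _ _ 0 k k (by omega)] at key
  have hf : MZ.f (X 0 : MvPolynomial (Fin 2) ℤ) (X 1) k 0 = ∑ i ∈ Finset.range (k+1),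
          (X 0 : MvPolynomial (Fin 2) ℤ) ^ i * (X 1) ^ (i * (k + 1 - i)) := by
    rw [MZ.f, Finset.Nat.sum_antidiagonal_eq_sum_range_succ_mk]
    refine Finset.sum_congr rfl fun i hi => ?_
    have : k - i + 1 = k + 1 - i := by
      have := Finset.mem_range.1 hi
      omega
    simp [MZ.e, MZ.G_zero_left, this]
  rw [hf] at key
  simp only [MZ.K, pow_zero, Finset.range_zero, Finset.prod_empty, mul_one] at key
  rw [← key, ← MZ.sum_cond, ← Fintype.sum_prod_type', Finset.sum_filter]
  refine Finset.sum_congr rfl fun pw _ => ?_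
  obtain ⟨P, w⟩ := pw
  classical
  refine if_ctx_congr ?_ (fun hc => ?_) (fun _ => rfl)
  · simp [MZ.cond, IsMotzkin, and_assoc]
  · refine Finset.prod_congr rfl fun i _ => ?_
    have hL : P i = Step.L → w i = true := hc.2.2.1 i
    simp only [Nat.cast_zero, zero_add]
    revert hL
    generalize P i = s
    generalize w i = x
    cases s <;> cases x <;> simp [MZ.g]
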